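/- arXiv:1903.07036 — 2 statements merged into one kernel-verified Lean document; each statement's English description precedes it below -/
import Mathlib

section
/- Let A be a real n×n matrix with spectral radius ρ(A), and let Q be positive definite with smallest eigenvalue λ_min(Q) > 0. Then for every positive semidefinite P₀ and every k ≥ 1, Tr[h^k(P₀)] ≥ λ_min(Q) · ρ(A)^{2(k−1)}. -/
open Matrix

/-- An eigenvalue is bounded in norm by the Frobenius norm. -/
theorem Matrix.norm_sq_le_sum_norm_sq_of_mem_spectrum {ι 𝕜 : Type*} [Fintype ι] [DecidableEq ι]
    [RCLike 𝕜] {M : Matrix ι ι 𝕜} {c : 𝕜} (hc : c ∈ spectrum 𝕜 M) :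
    ‖c‖ ^ 2 ≤ ∑ i, ∑ j, ‖M i j‖ ^ 2 := by
  rw [spectrum.mem_iff, Matrix.isUnit_iff_isUnit_det, isUnit_iff_ne_zero, not_not] at hc
  obtain ⟨v, hv, hMv⟩ := Matrix.exists_mulVec_eq_zero_iff.mpr hc
  have hM (i : ι) : c * v i = ∑ j, M i j * v j := by
    have := congrFun hMv i
    rw [Matrix.sub_mulVec, Algebra.algebraMap_eq_smul_one, Matrix.smul_mulVec, Matrix.one_mulVec,
      Pi.sub_apply, Pi.zero_apply, sub_eq_zero] at this
    exact this
  have hpos : 0 < ∑ j, ‖v j‖ ^ 2 := by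
    obtain ⟨j, hj⟩ := Function.ne_iff.mp hv
    exact Finset.sum_pos' (fun _ _ => by positivity)
      ⟨j, Finset.mem_univ j, pow_pos (norm_pos_iff.mpr hj) 2⟩
  refine le_of_mul_le_mul_right ?_ hpos
  rw [Finset.mul_sum, Finset.sum_mul]
  refine Finset.sum_le_sum fun i _ => ?_
  calc ‖c‖ ^ 2 * ‖v i‖ ^ 2 = ‖∑ j, M i j * v j‖ ^ 2 := by rw [← hM, norm_mul, mul_pow]
    _ ≤ (∑ j, ‖M i j‖ * ‖v j‖) ^ 2 := by
      gcongr
      exact (norm_sum_le _ _).trans_eq (by simp only [norm_mul])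
    _ ≤ _ := Finset.sum_mul_sq_le_sq_mul_sq _ _ _

/-- Subtracting a lower bound of the spectrum from a Hermitian matrix leaves it positive
semidefinite. -/
theorem Matrix.IsHermitian.posSemidef_sub_smul_one {ι : Type*} [Fintype ι] [DecidableEq ι]
    {Q : Matrix ι ι ℝ} (hQ : Q.IsHermitian) {lam : ℝ} (hlam : ∀ μ ∈ spectrum ℝ Q, lam ≤ μ) :
    (Q - lam • (1 : Matrix ι ι ℝ)).PosSemidef := by
  rw [Matrix.posSemidef_iff_isHermitian_and_spectrum_nonneg]
  refine ⟨hQ.sub (by simp [Matrix.IsHermitian]), fun μ hμ => ?_⟩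
  rw [← Algebra.algebraMap_eq_smul_one, ← spectrum.sub_singleton_eq] at hμ
  obtain ⟨ν, hν, _, rfl, rfl⟩ := hμ
  exact sub_nonneg.mpr (hlam ν hν)

/-- The iterates of the Lyapunov operator dominate `lam • A ^ k * (A ^ k)ᵀ` when
`lam • 1` is dominated by `Q`. -/
theorem Matrix.posSemidef_lyapunov_iterate_sub {ι : Type*} [Fintype ι] [DecidableEq ι]
    {A Q P : Matrix ι ι ℝ} {lam : ℝ} (hQ : Q.PosSemidef)
    (hlam : (Q - lam • (1 : Matrix ι ι ℝ)).PosSemidef) (hP : P.PosSemidef) (k : ℕ) :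
    ((fun X => A * X * Aᵀ + Q)^[k + 1] P - lam • (A ^ k * (A ^ k)ᵀ)).PosSemidef := by
  induction k with
  | zero =>
    have := (hP.mul_mul_conjTranspose_same A).add hlam
    simpa [add_sub_assoc] using this
  | succ k ih =>
    have := (ih.mul_mul_conjTranspose_same A).add hQ
    rw [Function.iterate_succ_apply']
    convert this using 1
    simp only [Matrix.conjTranspose_eq_transpose_of_trivial, pow_succ', Matrix.transpose_mul,
      Matrix.mul_sub, Matrix.sub_mul, Matrix.mul_smul, Matrix.smul_mul, Matrix.mul_assoc]
    abel

/-- For a real matrix `A` with spectral radius `ρ` and `Q ≻ 0` with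
smallest eigenvalue `lam > 0`, for every `P₀ ⪰ 0` and every `k ≥ 1`,
`Tr[h^k(P₀)] ≥ lam * ρ^(2(k-1))` where `h(X) = A X Aᵀ + Q`. -/
theorem stmt_3 (n : ℕ) (A Q : Matrix (Fin n) (Fin n) ℝ) (hQ : Q.PosDef)
    (lam ρ : ℝ) (hlampos : 0 < lam)
    (hlam : lam ∈ spectrum ℝ Q ∧ ∀ μ ∈ spectrum ℝ Q, lam ≤ μ)
    (hρ : (∃ μ ∈ spectrum ℂ (A.map Complex.ofReal), ‖μ‖ = ρ) ∧
      ∀ μ ∈ spectrum ℂ (A.map Complex.ofReal), ‖μ‖ ≤ ρ)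
    (P₀ : Matrix (Fin n) (Fin n) ℝ) (hP₀ : P₀.PosSemidef) :
    ∀ k : ℕ, 1 ≤ k →
      lam * ρ ^ (2 * (k - 1)) ≤ ((fun X => A * X * Aᵀ + Q)^[k] P₀).trace := by
  intro k hk
  obtain ⟨k, rfl⟩ := Nat.exists_eq_add_of_le' hk
  obtain ⟨⟨μ, hμ, rfl⟩, -⟩ := hρ
  have htrace := (Matrix.posSemidef_lyapunov_iterate_sub (A := A) hQ.posSemidef
    (hQ.isHermitian.posSemidef_sub_smul_one hlam.2) hP₀ k).trace_nonneg
  rw [Matrix.trace_sub, Matrix.trace_smul, smul_eq_mul, sub_nonneg] at htrace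
  refine le_trans ?_ htrace
  rw [Nat.add_sub_cancel]
  refine mul_le_mul_of_nonneg_left ?_ hlampos.le
  have hpow : A.map Complex.ofReal ^ k = (A ^ k).map Complex.ofReal :=
    (map_pow Complex.ofRealHom.mapMatrix A k).symm
  have hbound := Matrix.norm_sq_le_sum_norm_sq_of_mem_spectrum (spectrum.pow_mem_pow _ k hμ)
  rw [hpow, norm_pow, ← pow_mul, mul_comm k 2] at hbound
  refine hbound.trans_eq ?_
  simp [Matrix.trace, Matrix.mul_apply, sq, -Matrix.transpose_pow]
end

section
/- Suppose the positive semidefinite matrix P̄ satisfies the steady-state Riccati equation P̄ = g(h(P̄)). Then the iterates of the Lyapunov operator applied to P̄ are nondecreasing in the Loewner order: for all natural numbers t₁ ≥ t₂, h^{t₁}(P̄) ⪰ h^{t₂}(P̄), and consequently Tr[h^{t₁}(P̄)] ≥ Tr[h^{t₂}(P̄)]. -/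
open Matrix

open scoped MatrixOrder

section

variable {n m : Type*} [Fintype n] [Fintype m] [DecidableEq m]

theorem lyapunov_monotone (A Q : Matrix n n ℝ) :
    Monotone fun X : Matrix n n ℝ => A * X * Aᵀ + Q := by
  intro X Y hXY
  rw [Matrix.le_iff] at hXY ⊢
  have := hXY.mul_mul_conjTranspose_same A
  rw [conjTranspose_eq_transpose_of_trivial] at this
  convert this using 1
  simp only [Matrix.mul_sub, Matrix.sub_mul]
  abel

theorem lyapunov_posSemidef {A Q X : Matrix n n ℝ} (hX : X.PosSemidef) (hQ : Q.PosSemidef) :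
    (A * X * Aᵀ + Q).PosSemidef := by
  have := hX.mul_mul_conjTranspose_same A
  rw [conjTranspose_eq_transpose_of_trivial] at this
  exact this.add hQ

theorem measurement_update_le {Y : Matrix n n ℝ} (hY : Y.PosSemidef) (C : Matrix m n ℝ)
    {R : Matrix m m ℝ} (hR : R.PosDef) :
    Y - Y * Cᵀ * (C * Y * Cᵀ + R)⁻¹ * C * Y ≤ Y := by
  have hS : (C * Y * Cᵀ + R).PosSemidef := by
    have := hY.mul_mul_conjTranspose_same C
    rw [conjTranspose_eq_transpose_of_trivial] at this
    exact this.add hR.posSemidef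
  have hYt : Yᵀ = Y := by
    rw [← conjTranspose_eq_transpose_of_trivial]
    exact hY.isHermitian
  rw [Matrix.le_iff, sub_sub_cancel]
  have := hS.inv.mul_mul_conjTranspose_same (Y * Cᵀ)
  rw [conjTranspose_eq_transpose_of_trivial, transpose_mul, transpose_transpose, hYt,
    ← Matrix.mul_assoc] at this
  exact this

end

/-- If `P̄ ⪰ 0` satisfies the steady-state Riccati equation
`P̄ = g(h(P̄))` with `h(X) = A X Aᵀ + Q` and
`g(X) = X − X Cᵀ (C X Cᵀ + R)⁻¹ C X`, then the Lyapunov iterates of `P̄` are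
nondecreasing in the Loewner order: for all `t₁ ≥ t₂`,
`h^{t₁}(P̄) ⪰ h^{t₂}(P̄)` and `Tr[h^{t₁}(P̄)] ≥ Tr[h^{t₂}(P̄)]`. -/
theorem stmt_5 (n m : ℕ) (A Q : Matrix (Fin n) (Fin n) ℝ) (hQ : Q.PosSemidef)
    (C : Matrix (Fin m) (Fin n) ℝ) (R : Matrix (Fin m) (Fin m) ℝ) (hR : R.PosDef)
    (P : Matrix (Fin n) (Fin n) ℝ) (hP : P.PosSemidef)
    (hric : P =
      (fun Y => Y - Y * Cᵀ * (C * Y * Cᵀ + R)⁻¹ * C * Y) (A * P * Aᵀ + Q)) :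
    ∀ t₁ t₂ : ℕ, t₂ ≤ t₁ →
      (((fun X => A * X * Aᵀ + Q)^[t₁] P) -
        ((fun X => A * X * Aᵀ + Q)^[t₂] P)).PosSemidef ∧
      ((fun X => A * X * Aᵀ + Q)^[t₂] P).trace ≤
        ((fun X => A * X * Aᵀ + Q)^[t₁] P).trace := by
  have hle : P ≤ A * P * Aᵀ + Q := by
    conv_lhs => rw [hric]
    exact measurement_update_le (lyapunov_posSemidef hP hQ) C hR
  intro t₁ t₂ ht
  have hpsd := Matrix.le_iff.mp
    ((lyapunov_monotone A Q).monotone_iterate_of_le_map hle ht)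
  refine ⟨hpsd, ?_⟩
  have htr := hpsd.trace_nonneg
  rw [trace_sub] at htr
  exact sub_nonneg.mp htr
end
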